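/- Let 1 ≤ d ≤ n be integers. If a set A ⊆ {0,1}ⁿ is not an (n,d)-universal set, then there exist two distinct functions f, g : {0,1}ⁿ → {0,1}, each with at most d relevant variables, such that f(a) = g(a) for every a ∈ A. Consequently, every equivalent set for the class d-Junta is an (n,d)-universal set. -/

import Mathlib

/-- `S ⊆ {0,1}ⁿ` is an `(n,d)`-universal set: for every choice of `d` increasing indices
and every pattern `σ ∈ {0,1}^d` some `s ∈ S` realizes the pattern on those indices. -/
def IsUniversalSet (n d : ℕ) (S : Set (Fin n → Bool)) : Prop :=
  ∀ idx : Fin d → Fin n, StrictMono idx →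
    ∀ σ : Fin d → Bool, ∃ s ∈ S, ∀ j : Fin d, s (idx j) = σ j

/-- The variable `x_i` is relevant in the boolean function `f` if flipping the `i`-th
coordinate of some assignment changes the value of `f`. -/
def IsRelevant {n : ℕ} (f : (Fin n → Bool) → Bool) (i : Fin n) : Prop :=
  ∃ a : Fin n → Bool, f (Function.update a i false) ≠ f (Function.update a i true)

/-- The class `d`-Junta: boolean functions on `n` variables with at most `d` relevant
variables. -/
def Junta (n d : ℕ) : Set ((Fin n → Bool) → Bool) :=
  {f | Set.ncard {i | IsRelevant f i} ≤ d}

/-- `A ⊆ {0,1}ⁿ` is an equivalent set for a class `C` of boolean functions if any two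
distinct members of `C` differ on some point of `A`. -/
def IsEquivalentSetFor {n : ℕ} (A : Set (Fin n → Bool))
    (C : Set ((Fin n → Bool) → Bool)) : Prop :=
  ∀ f ∈ C, ∀ g ∈ C, f ≠ g → ∃ a ∈ A, f a ≠ g a

/-- Let `1 ≤ d ≤ n`.  If `A ⊆ {0,1}ⁿ` is not an `(n,d)`-universal
set, then there are two distinct functions with at most `d` relevant variables agreeing
on all of `A`.  Consequently, every equivalent set for `d`-Junta is an
`(n,d)`-universal set. -/
theorem stmt_13 (n d : ℕ) (hd : 1 ≤ d) (hdn : d ≤ n) :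
    (∀ A : Set (Fin n → Bool), ¬ IsUniversalSet n d A →
      ∃ f g : (Fin n → Bool) → Bool, f ≠ g ∧ f ∈ Junta n d ∧ g ∈ Junta n d ∧
        ∀ a ∈ A, f a = g a) ∧
    (∀ A : Set (Fin n → Bool), IsEquivalentSetFor A (Junta n d) →
      IsUniversalSet n d A) := by
  have key : ∀ A : Set (Fin n → Bool), ¬ IsUniversalSet n d A →
      ∃ f g : (Fin n → Bool) → Bool, f ≠ g ∧ f ∈ Junta n d ∧ g ∈ Junta n d ∧
        ∀ a ∈ A, f a = g a := by
    intro A hA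
    unfold IsUniversalSet at hA
    push Not at hA
    obtain ⟨idx, hidx, σ, hσ⟩ := hA
    refine ⟨fun a => decide (∀ j, a (idx j) = σ j), fun _ => false, ?_, ?_, ?_, ?_⟩
    · intro h
      have h1 := congrFun h (Function.extend idx σ (fun _ => false))
      have h2 : ∀ j, Function.extend idx σ (fun _ => false) (idx j) = σ j :=
        fun j => hidx.injective.extend_apply σ _ j
      exact (of_decide_eq_false h1) h2
    · have hsub : {i | IsRelevant (fun a : Fin n → Bool => decide (∀ j, a (idx j) = σ j)) i}
          ⊆ Set.range idx := by
        rintro i ⟨a, ha⟩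
        by_contra hi
        apply ha
        have hne : ∀ j, idx j ≠ i := fun j hj => hi ⟨j, hj⟩
        simp [Function.update_of_ne (hne _)]
      have h1 := Set.ncard_le_ncard hsub (Set.toFinite _)
      have h2 : (Set.range idx).ncard ≤ d := by
        rw [← Set.image_univ]
        refine (Set.ncard_image_le (Set.toFinite _)).trans ?_
        simp [Set.ncard_univ]
      exact h1.trans h2
    · simp [Junta, IsRelevant]
    · intro a ha
      obtain ⟨j, hj⟩ := hσ a ha
      exact decide_eq_false (fun h => hj (h j))
  refine ⟨key, fun A hA => ?_⟩
  by_contra hU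
  obtain ⟨f, g, hne, hf, hg, hfg⟩ := key A hU
  obtain ⟨a, ha, hn⟩ := hA f hf g hg hne
  exact hn (hfg a ha)
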